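/- Chain estimate: let Ω ⊊ ℝ^n be a bounded domain with Whitney decomposition W(Ω), let w be a doubling weight in Ω with constant D, and let C(Q) = (Q_0, …, Q_k) be a chain in Ω joining the cube Q_0 to Q_k = Q ∈ W(Ω). Then for every u ∈ L^1_loc(Ω; w dx), |u_{w;Q*} − u_{w;Q_0*}| ≤ C(n, D) Σ_{R∈C(Q)} w(R*)^{-1} ∫_{R*} |u(x) − u_{w;R*}| w(x) dx. -/

import Mathlib

open MeasureTheory ENNReal NNReal Set

noncomputable section

/-- Euclidean space `ℝ^n`. -/
abbrev Rn (n : ℕ) := EuclideanSpace ℝ (Fin n)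

/-- The half-open cube `Q(x, r)` with midpoint `x` and side length `2r`. -/
def CubeC {n : ℕ} (x : Rn n) (r : ℝ) : Set (Rn n) :=
  {y | ∀ i, x i - r ≤ y i ∧ y i < x i + r}

/-- The weighted measure `w(E) = ∫_E w dx` of a set, as an extended nonnegative real. -/
def wMass {n : ℕ} (w : Rn n → ℝ) (E : Set (Rn n)) : ℝ≥0∞ :=
  ∫⁻ x in E, ENNReal.ofReal (w x)

/-- The measure `w dx`. -/
def wMeasure {n : ℕ} (w : Rn n → ℝ) : Measure (Rn n) :=
  volume.withDensity fun x => ENNReal.ofReal (w x)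

/-- The weighted average `u_{w;E} = w(E)⁻¹ ∫_E u w dx`. -/
def wAvg {n : ℕ} (w : Rn n → ℝ) (E : Set (Rn n)) (u : Rn n → ℝ) : ℝ :=
  ⨍ x in E, u x ∂(wMeasure w)

/-- A weight `w` is doubling in the open set `Ω` with constant `D`:
`w(Ω ∩ Q(x,2r)) ≤ D w(Ω ∩ Q(x,r))` for every cube `Q(x,r)` with midpoint `x ∈ Ω`. -/
def DoublingIn {n : ℕ} (Ω : Set (Rn n)) (w : Rn n → ℝ) (D : ℝ) : Prop :=
  ∀ x ∈ Ω, ∀ r : ℝ, 0 < r →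
    wMass w (Ω ∩ CubeC x (2 * r)) ≤ ENNReal.ofReal D * wMass w (Ω ∩ CubeC x r)

/-- The distance between two sets. -/
def setDist {n : ℕ} (A B : Set (Rn n)) : ℝ :=
  sInf {d : ℝ | ∃ x ∈ A, ∃ y ∈ B, d = dist x y}

/-- A Whitney decomposition of `Ω` with dimensional constant `Cdim`: a countable family of
pairwise disjoint half-open cubes covering `Ω`, such that the side length of each dilated
cube `Q* = (9/8)Q` is comparable (with constant `Cdim`) to its distance from `∂Ω`, and the
dilated cubes have overlap bounded by `Cdim`. -/
structure WhitneyDecomp (n : ℕ) (Ω : Set (Rn n)) (Cdim : ℝ) where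
  cubes : Set (Set (Rn n))
  countable : cubes.Countable
  center : Set (Rn n) → Rn n
  radius : Set (Rn n) → ℝ
  radius_pos : ∀ Q ∈ cubes, 0 < radius Q
  eq_cube : ∀ Q ∈ cubes, Q = CubeC (center Q) (radius Q)
  pairwise_disjoint : cubes.PairwiseDisjoint id
  union_eq : ⋃₀ cubes = Ω
  dist_lower : ∀ Q ∈ cubes,
    9 / 4 * radius Q ≤ Cdim * setDist (CubeC (center Q) (9 / 8 * radius Q)) (frontier Ω)
  dist_upper : ∀ Q ∈ cubes,
    setDist (CubeC (center Q) (9 / 8 * radius Q)) (frontier Ω) ≤ Cdim * (9 / 4 * radius Q)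
  overlap_finite : ∀ x : Rn n, {Q ∈ cubes | x ∈ CubeC (center Q) (9 / 8 * radius Q)}.Finite
  overlap_le : ∀ x : Rn n,
    (({Q ∈ cubes | x ∈ CubeC (center Q) (9 / 8 * radius Q)}).ncard : ℝ) ≤ Cdim

/-- The dilated Whitney cube `Q* = (9/8)Q`. -/
def Qstar {n : ℕ} {Ω : Set (Rn n)} {Cdim : ℝ} (W : WhitneyDecomp n Ω Cdim)
    (Q : Set (Rn n)) : Set (Rn n) :=
  CubeC (W.center Q) (9 / 8 * W.radius Q)

/-- Two Whitney cubes `P, Q` are chained (with constant `c`) if there is a cube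
`R ⊆ P* ∩ Q*` with `l(R) ≥ c · max{l(P*), l(Q*)}`. -/
def ChainLink {n : ℕ} {Ω : Set (Rn n)} {Cdim : ℝ} (W : WhitneyDecomp n Ω Cdim) (c : ℝ)
    (P Q : Set (Rn n)) : Prop :=
  ∃ (z : Rn n) (r : ℝ), 0 < r ∧ CubeC z r ⊆ Qstar W P ∩ Qstar W Q ∧
    c * max (2 * (9 / 8 * W.radius P)) (2 * (9 / 8 * W.radius Q)) ≤ 2 * r

/-- `L` is a chain of Whitney cubes joining `P` to `Q`: a list of distinct Whitney cubes
starting at `P`, ending at `Q`, whose consecutive members are chained. -/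
def IsChainFrom {n : ℕ} {Ω : Set (Rn n)} {Cdim : ℝ} (W : WhitneyDecomp n Ω Cdim) (c : ℝ)
    (P Q : Set (Rn n)) (L : List (Set (Rn n))) : Prop :=
  (∀ R ∈ L, R ∈ W.cubes) ∧ L.Nodup ∧ L.head? = some P ∧ L.getLast? = some Q ∧
    L.Chain' (ChainLink W c)

/-- A Boman chain decomposition of `Ω` with constants `Cdim` (Whitney), `cdim` (chain link)
and `N` (Boman): a Whitney decomposition together with a chain decomposition with common
central cube such that the shadow of each `R` is contained in `NR`. -/
structure BomanDecomp (n : ℕ) (Ω : Set (Rn n)) (Cdim cdim N : ℝ)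
    extends WhitneyDecomp n Ω Cdim where
  central : Set (Rn n)
  central_mem : central ∈ cubes
  chain : Set (Rn n) → List (Set (Rn n))
  chain_isChain : ∀ Q ∈ cubes, IsChainFrom toWhitneyDecomp cdim central Q (chain Q)
  shadow_subset : ∀ R ∈ cubes, ∀ Q ∈ cubes, R ∈ chain Q →
    Q ⊆ CubeC (center R) (N * radius R)

theorem mem_cubeC_self {n : ℕ} (x : Rn n) {r : ℝ} (hr : 0 < r) : x ∈ CubeC x r :=
  fun _ => ⟨by linarith, by linarith⟩

theorem measurableSet_cubeC {n : ℕ} (x : Rn n) (r : ℝ) : MeasurableSet (CubeC x r) := by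
  have : CubeC x r = ⋂ i, {y : Rn n | x i - r ≤ y i ∧ y i < x i + r} := by
    ext y; simp [CubeC]
  rw [this]
  refine MeasurableSet.iInter fun i => ?_
  have hi : Measurable fun y : Rn n => y i := by fun_prop
  exact hi measurableSet_Ico

theorem convex_cubeC {n : ℕ} (x : Rn n) (r : ℝ) : Convex ℝ (CubeC x r) := by
  intro y hy z hz a b ha hb hab i
  exact convex_Ico (x i - r) (x i + r) (hy i) (hz i) ha hb hab

theorem cubeC_subset_cubeC_of_mem {n : ℕ} {x z : Rn n} {ρ s : ℝ} (hz : z ∈ CubeC x ρ)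
    (hs : 2 * ρ ≤ s) : CubeC x ρ ⊆ CubeC z s := by
  intro y hy i
  have h₁ := hy i
  have h₂ := hz i
  constructor <;> linarith

theorem setDist_le_dist {n : ℕ} {A B : Set (Rn n)} {x y : Rn n} (hx : x ∈ A) (hy : y ∈ B) :
    setDist A B ≤ dist x y := by
  refine csInf_le ⟨0, ?_⟩ ⟨x, hx, y, hy, rfl⟩
  rintro d ⟨a, -, b, -, rfl⟩
  exact dist_nonneg

theorem setDist_nonneg {n : ℕ} (A B : Set (Rn n)) : 0 ≤ setDist A B := by
  refine Real.sInf_nonneg ?_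
  rintro d ⟨a, -, b, -, rfl⟩
  exact dist_nonneg

theorem disjoint_closure_of_setDist_pos {n : ℕ} {A B : Set (Rn n)} (h : 0 < setDist A B) :
    Disjoint (closure A) B := by
  rw [Set.disjoint_left]
  intro x hx hxB
  obtain ⟨y, hy, hxy⟩ := Metric.mem_closure_iff.1 hx _ h
  have := setDist_le_dist hy hxB
  rw [dist_comm] at this
  linarith

theorem closure_Qstar_subset {n : ℕ} {Ω : Set (Rn n)} {Cdim : ℝ} (hΩ : IsOpen Ω)
    (W : WhitneyDecomp n Ω Cdim) {Q : Set (Rn n)} (hQ : Q ∈ W.cubes) :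
    closure (Qstar W Q) ⊆ Ω := by
  have hr := W.radius_pos Q hQ
  have hpos : 0 < setDist (Qstar W Q) (frontier Ω) := by
    refine (setDist_nonneg _ _).lt_of_ne fun h => ?_
    have hlow := W.dist_lower Q hQ
    change _ ≤ Cdim * setDist (Qstar W Q) (frontier Ω) at hlow
    rw [← h] at hlow
    linarith
  have hdisj := Set.disjoint_left.1 (disjoint_closure_of_setDist_pos hpos)
  refine (convex_cubeC _ _).isPreconnected.closure.subset_of_closure_inter_subset hΩ
    ⟨W.center Q, subset_closure (mem_cubeC_self _ (by linarith)), ?_⟩ ?_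
  · exact W.union_eq.subset ⟨Q, hQ, (W.eq_cube Q hQ).superset (mem_cubeC_self _ hr)⟩
  · rintro x ⟨hx, hxQ⟩
    by_contra hxΩ
    exact hdisj hxQ (hΩ.frontier_eq ▸ ⟨hx, hxΩ⟩)

theorem DoublingIn.iterate {n : ℕ} {Ω : Set (Rn n)} {w : Rn n → ℝ} {D : ℝ}
    (h : DoublingIn Ω w D) {x : Rn n} (hx : x ∈ Ω) {r : ℝ} (hr : 0 < r) (m : ℕ) :
    wMass w (Ω ∩ CubeC x (2 ^ m * r)) ≤ ENNReal.ofReal D ^ m * wMass w (Ω ∩ CubeC x r) := by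
  induction m with
  | zero => simp
  | succ m ih =>
    calc wMass w (Ω ∩ CubeC x (2 ^ (m + 1) * r))
        = wMass w (Ω ∩ CubeC x (2 * (2 ^ m * r))) := by rw [pow_succ']; ring_nf
      _ ≤ ENNReal.ofReal D * wMass w (Ω ∩ CubeC x (2 ^ m * r)) := h x hx _ (by positivity)
      _ ≤ ENNReal.ofReal D * (ENNReal.ofReal D ^ m * wMass w (Ω ∩ CubeC x r)) := by gcongr
      _ = ENNReal.ofReal D ^ (m + 1) * wMass w (Ω ∩ CubeC x r) := by ring

/-- A cube inside a larger one, with comparable side lengths, carries a fixed proportion of the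
mass of a doubling weight. -/
theorem DoublingIn.wMeasure_cubeC_le {n : ℕ} {Ω : Set (Rn n)} {w : Rn n → ℝ} {D : ℝ}
    (h : DoublingIn Ω w D) {x z : Rn n} {ρ r : ℝ} (hr : 0 < r) (hΩ : CubeC x ρ ⊆ Ω)
    (hz : CubeC z r ⊆ CubeC x ρ) {m : ℕ} (hm : 2 * ρ ≤ 2 ^ m * r) :
    wMeasure w (CubeC x ρ) ≤ ENNReal.ofReal D ^ m * wMeasure w (CubeC z r) := by
  have hzx : z ∈ CubeC x ρ := hz (mem_cubeC_self z hr)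
  have hit := h.iterate (hΩ hzx) hr m
  rw [Set.inter_eq_right.2 (hz.trans hΩ)] at hit
  rw [wMeasure, withDensity_apply _ (measurableSet_cubeC _ _),
    withDensity_apply _ (measurableSet_cubeC _ _)]
  exact (lintegral_mono_set (Set.subset_inter hΩ (cubeC_subset_cubeC_of_mem hzx hm))).trans hit

theorem setAverage_abs_nonneg {α : Type*} [MeasurableSpace α] {μ : Measure α} (A : Set α)
    (u : α → ℝ) : 0 ≤ ⨍ x in A, |u x| ∂μ := by
  rw [setAverage_eq, smul_eq_mul]
  exact mul_nonneg (inv_nonneg.2 measureReal_nonneg) (integral_nonneg fun _ => abs_nonneg _)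

/-- The averages over a set and over a subset of comparable measure differ by at most a multiple
of the mean oscillation over the larger set. -/
theorem abs_setAverage_sub_setAverage_le {α : Type*} [MeasurableSpace α] {μ : Measure α}
    {A B : Set α} {u : α → ℝ} {K : ℝ} (hK : 0 ≤ K) (hAB : A ⊆ B) (hB : μ B ≠ ∞)
    (hμ : μ.real B ≤ K * μ.real A) (hu : IntegrableOn u B μ) :
    |(⨍ x in A, u x ∂μ) - ⨍ x in B, u x ∂μ| ≤
      K * ⨍ x in B, |u x - ⨍ y in B, u y ∂μ| ∂μ := by
  set a := ⨍ y in B, u y ∂μ with ha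
  have hA : μ A ≠ ∞ := measure_ne_top_of_subset hAB hB
  have hint : IntegrableOn (fun x => u x - a) B μ := hu.sub (integrableOn_const hB)
  have hB0 : 0 ≤ ⨍ x in B, |u x - a| ∂μ := setAverage_abs_nonneg _ _
  rcases (measureReal_nonneg (μ := μ) (s := A)).eq_or_lt with h0 | hpos
  · have hB' : μ.real B = 0 :=
      le_antisymm (by simpa [← h0] using hμ) measureReal_nonneg
    have ha0 : a = 0 := by rw [ha, setAverage_eq, hB', _root_.inv_zero, zero_smul]
    rw [setAverage_eq, ← h0, ha0]
    simpa [ha0] using mul_nonneg hK hB0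
  · have hposB : 0 < μ.real B := hpos.trans_le (measureReal_mono hAB hB)
    have hsub : (⨍ x in A, u x ∂μ) - a = (μ.real A)⁻¹ * ∫ x in A, (u x - a) ∂μ := by
      rw [integral_sub (hu.mono_set hAB) (integrableOn_const hA), setIntegral_const,
        setAverage_eq, smul_eq_mul, smul_eq_mul]
      field_simp
    have hosc : |∫ x in A, (u x - a) ∂μ| ≤ ∫ x in B, |u x - a| ∂μ :=
      (abs_integral_le_integral_abs).trans
        (setIntegral_mono_set hint.abs (Filter.Eventually.of_forall fun _ => abs_nonneg _)
          hAB.eventuallyLE)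
    have hinv : (μ.real A)⁻¹ ≤ K * (μ.real B)⁻¹ := by
      rw [← div_eq_mul_inv, le_div_iff₀ hposB, inv_mul_le_iff₀ hpos, mul_comm]
      exact hμ
    rw [hsub, abs_mul, abs_of_pos (inv_pos.2 hpos), setAverage_eq μ (fun x => |u x - a|),
      smul_eq_mul, ← mul_assoc]
    exact mul_le_mul hinv hosc (abs_nonneg _) (mul_nonneg hK (inv_nonneg.2 hposB.le))

/-- Telescoping along a chain whose consecutive increments are controlled by `g`. -/
theorem List.IsChain.abs_sub_le_sum {α : Type*} {f g : α → ℝ} {K : ℝ} (hK : 0 ≤ K)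
    (hg : ∀ a, 0 ≤ g a) {q : α} :
    ∀ {p : α} {L : List α}, (p :: L).getLast? = some q →
      (p :: L).IsChain (fun a b => |f b - f a| ≤ K * (g a + g b)) →
      |f q - f p| ≤ K * (2 * ((p :: L).map g).sum - g p)
  | p, [], hq, _ => by
    obtain rfl : p = q := by simpa using hq
    have := mul_nonneg hK (hg p)
    simp only [sub_self, abs_zero, List.map_cons, List.map_nil, List.sum_cons, List.sum_nil]
    linarith
  | p, p' :: L, hq, hL => by
    rw [List.isChain_cons_cons] at hL
    have ih := List.IsChain.abs_sub_le_sum hK hg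
      (by simpa only [List.getLast?_cons_cons] using hq) hL.2
    have htri := abs_sub_le (f q) (f p') (f p)
    rw [List.map_cons, List.sum_cons]
    linarith [hL.1]

/-- chain estimate: let `Ω ⊊ ℝ^n` be a bounded domain with Whitney
decomposition, `w` a doubling weight in `Ω` with constant `D`, and `L = (Q₀, …, Q_k)` a
chain joining `P = Q₀` to `Q = Q_k`. Then for every `u ∈ L¹_loc(Ω; w dx)`,
`|u_{w;Q*} − u_{w;P*}| ≤ C(n, D) Σ_{R∈L} w(R*)⁻¹ ∫_{R*} |u − u_{w;R*}| w dx`. -/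
theorem chain_estimate
    (n : ℕ) (hn : 0 < n) (D c : ℝ) (hD : 0 < D) (hc : 0 < c) :
    ∃ C : ℝ, 0 < C ∧
      ∀ (Cdim : ℝ) (Ω : Set (Rn n)),
        IsOpen Ω → IsConnected Ω → Bornology.IsBounded Ω →
      ∀ W : WhitneyDecomp n Ω Cdim,
      ∀ w : Rn n → ℝ, LocallyIntegrableOn w Ω volume →
        (∀ᵐ x ∂(volume : Measure (Rn n)), x ∈ Ω → 0 < w x) →
        DoublingIn Ω w D →
      ∀ (P Q : Set (Rn n)) (L : List (Set (Rn n))),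
        P ∈ W.cubes → Q ∈ W.cubes → IsChainFrom W c P Q L →
      ∀ u : Rn n → ℝ, LocallyIntegrableOn u Ω (wMeasure w) →
        |wAvg w (Qstar W Q) u - wAvg w (Qstar W P) u| ≤
          C * (L.map fun R =>
            ⨍ x in Qstar W R, |u x - wAvg w (Qstar W R) u| ∂(wMeasure w)).sum := by
  obtain ⟨m, hm⟩ := pow_unbounded_of_one_lt (2 / c) (one_lt_two (α := ℝ))
  refine ⟨2 * D ^ m, by positivity, ?_⟩
  intro Cdim Ω hΩ _ hbdd W w hw _ hdbl P Q L _ _ ⟨hcubes, _, hhead, hlast, hchain⟩ u hu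
  have hDm : 0 ≤ D ^ m := by positivity
  set f : Set (Rn n) → ℝ := fun R => wAvg w (Qstar W R) u
  set g : Set (Rn n) → ℝ := fun R => ⨍ x in Qstar W R, |u x - f R| ∂(wMeasure w)
  have hg : ∀ R, 0 ≤ g R := fun R => setAverage_abs_nonneg _ _
  have hcompact : ∀ R ∈ W.cubes, IsCompact (closure (Qstar W R)) := fun R hR =>
    (hbdd.subset (subset_closure.trans (closure_Qstar_subset hΩ W hR))).isCompact_closure
  have hfin : ∀ R ∈ W.cubes, wMeasure w (Qstar W R) ≠ ∞ := fun R hR => by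
    have hint : IntegrableOn w (Qstar W R) :=
      (hw.integrableOn_compact_subset (closure_Qstar_subset hΩ W hR) (hcompact R hR)).mono_set
        subset_closure
    rw [wMeasure, Qstar, withDensity_apply _ (measurableSet_cubeC _ _)]
    exact hint.lintegral_lt_top.ne
  have hui : ∀ R ∈ W.cubes, IntegrableOn u (Qstar W R) (wMeasure w) := fun R hR =>
    (hu.integrableOn_compact_subset (closure_Qstar_subset hΩ W hR) (hcompact R hR)).mono_set
      subset_closure
  have hsub : ∀ R ∈ W.cubes, ∀ (z : Rn n) (r : ℝ), 0 < r → CubeC z r ⊆ Qstar W R →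
      c * (2 * (9 / 8 * W.radius R)) ≤ 2 * r →
      |wAvg w (CubeC z r) u - f R| ≤ D ^ m * g R := by
    intro R hR z r hr hz hcr
    have hscale : 2 * (9 / 8 * W.radius R) ≤ 2 ^ m * r := by
      rw [div_lt_iff₀ hc] at hm
      refine le_of_mul_le_mul_left ?_ hc
      nlinarith
    have hmass := hdbl.wMeasure_cubeC_le hr
      (subset_closure.trans (closure_Qstar_subset hΩ W hR)) hz hscale
    refine abs_setAverage_sub_setAverage_le hDm hz (hfin R hR) ?_ (hui R hR)
    have := ENNReal.toReal_mono (ENNReal.mul_ne_top (by simp)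
      (measure_ne_top_of_subset hz (hfin R hR))) hmass
    simpa [Qstar, Measure.real, ENNReal.toReal_mul, ENNReal.toReal_pow, hD.le] using this
  have hlink : L.IsChain fun a b => |f b - f a| ≤ D ^ m * (g a + g b) := by
    refine List.IsChain.imp_of_mem_imp ?_ hchain
    rintro a b ha hb ⟨z, r, hr, hz, hcr⟩
    have h₁ := hsub a (hcubes a ha) z r hr (hz.trans Set.inter_subset_left)
      ((mul_le_mul_of_nonneg_left (le_max_left _ _) hc.le).trans hcr)
    have h₂ := hsub b (hcubes b hb) z r hr (hz.trans Set.inter_subset_right)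
      ((mul_le_mul_of_nonneg_left (le_max_right _ _) hc.le).trans hcr)
    rw [abs_sub_comm] at h₂
    have htri := abs_sub_le (f b) (wAvg w (CubeC z r) u) (f a)
    linarith
  obtain ⟨T, rfl⟩ : ∃ T, L = P :: T := List.head?_eq_some_iff.1 hhead
  have hmain := List.IsChain.abs_sub_le_sum hDm hg hlast hlink
  have := mul_nonneg hDm (hg P)
  change |f Q - f P| ≤ 2 * D ^ m * ((P :: T).map g).sum
  linarith
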